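/- Let φ be a primitive of an operator antitone function φ′ on an interval E ⊂ ℝ. Then for every N×N Hermitian matrix X whose eigenvalues all lie in E, the set function f(A) = tr φ(X[A]) is submodular: f(S) + f(T) ≥ f(S∪T) + f(S∩T) for all S, T ⊆ {1,…,N}. Dually, if φ′ is operator monotone, f is supermodular. -/

import Mathlib

open ComplexOrder

/-- Spectral functional calculus: apply `g : ℝ → ℝ` to a Hermitian matrix via its
spectral decomposition. -/
noncomputable def hermApply {n : ℕ} (A : Matrix (Fin n) (Fin n) ℂ) (hA : A.IsHermitian)
    (g : ℝ → ℝ) : Matrix (Fin n) (Fin n) ℂ :=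
  (hA.eigenvectorUnitary : Matrix (Fin n) (Fin n) ℂ) *
    Matrix.diagonal (fun i => (g (hA.eigenvalues i) : ℂ)) *
    star (hA.eigenvectorUnitary : Matrix (Fin n) (Fin n) ℂ)

/-- `g` is operator monotone on `E`: for Hermitian matrices of any size whose spectra lie
in `E`, `A ⪰ B` implies `g(A) ⪰ g(B)` (positive semidefinite order). -/
def OperatorMonotoneOn (g : ℝ → ℝ) (E : Set ℝ) : Prop :=
  ∀ (n : ℕ) (A B : Matrix (Fin n) (Fin n) ℂ) (hA : A.IsHermitian) (hB : B.IsHermitian),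
    (∀ i, hA.eigenvalues i ∈ E) → (∀ i, hB.eigenvalues i ∈ E) →
    (A - B).PosSemidef → (hermApply A hA g - hermApply B hB g).PosSemidef

/-- `g` is operator antitone on `E` if `−g` is operator monotone on `E`. -/
def OperatorAntitoneOn (g : ℝ → ℝ) (E : Set ℝ) : Prop :=
  OperatorMonotoneOn (fun x => -g x) E

section
open scoped MatrixOrder
open Matrix

theorem Matrix.compression_nonneg {n : Type*} [Fintype n] {Z P : Matrix n n ℂ} (hZ : 0 ≤ Z)
    (hP : IsStarProjection P) : 0 ≤ P * Z * P := by
  simpa [hP.isSelfAdjoint.star_eq] using star_left_conjugate_nonneg hZ P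

variable {n : Type*} [Fintype n] [DecidableEq n]

/-- Intertwining relations between self-adjoint matrices pass to the functional calculus. -/
theorem Matrix.semiconjBy_cfc {x a b : Matrix n n ℂ} (ha : IsSelfAdjoint a)
    (hb : IsSelfAdjoint b) (h : SemiconjBy x a b) (f : ℝ → ℝ) :
    SemiconjBy x (cfc f a) (cfc f b) := by
  classical
  let s : Finset ℝ := a.finite_real_spectrum.toFinset ∪ b.finite_real_spectrum.toFinset
  let p : Polynomial ℝ := Lagrange.interpolate s id f
  have hp : ∀ y ∈ s, f y = p.eval y := fun y hy =>
    (Lagrange.eval_interpolate_at_node (v := id) f Function.injective_id.injOn hy).symm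
  have hfa : cfc f a = Polynomial.aeval a p := by
    rw [← cfc_polynomial p a ha]
    exact cfc_congr fun y hy => hp y (by simp [s, hy])
  have hfb : cfc f b = Polynomial.aeval b p := by
    rw [← cfc_polynomial p b hb]
    exact cfc_congr fun y hy => hp y (by simp [s, hy])
  rw [hfa, hfb, SemiconjBy, Polynomial.aeval_eq_sum_range, Polynomial.aeval_eq_sum_range,
    Finset.mul_sum, Finset.sum_mul]
  refine Finset.sum_congr rfl fun k _ => ?_
  rw [mul_smul_comm, smul_mul_assoc, (h.pow_right k).eq]

theorem Matrix.continuousOn_spectrum (f : ℝ → ℝ) (A : Matrix n n ℂ) :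
    ContinuousOn f (spectrum ℝ A) :=
  A.finite_real_spectrum.continuousOn f

/-- The real part of the trace of a product of two functional calculi, in terms of the
(squared moduli of the) overlaps of the two eigenbases. -/
theorem Matrix.exists_re_trace_cfc_mul_cfc {A B : Matrix n n ℂ} (hA : A.IsHermitian)
    (hB : B.IsHermitian) :
    ∃ w : n → n → ℝ, (∀ i j, 0 ≤ w i j) ∧ ∀ f k : ℝ → ℝ,
      (cfc f A * cfc k B).trace.re =
        ∑ i, ∑ j, w i j * (f (hA.eigenvalues i) * k (hB.eigenvalues j)) := by
  let U : Matrix n n ℂ := hA.eigenvectorUnitary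
  let V : Matrix n n ℂ := hB.eigenvectorUnitary
  refine ⟨fun i j => Complex.normSq ((star U * V) i j), fun i j => Complex.normSq_nonneg _, ?_⟩
  intro f k
  have h1 : cfc f A = U * diagonal (fun i => (f (hA.eigenvalues i) : ℂ)) * star U := by
    rw [hA.cfc_eq]; rfl
  have h2 : cfc k B = V * diagonal (fun i => (k (hB.eigenvalues i) : ℂ)) * star V := by
    rw [hB.cfc_eq]; rfl
  have h3 : (cfc f A * cfc k B).trace =
      (diagonal (fun i => (f (hA.eigenvalues i) : ℂ)) * (star U * V) *
        (diagonal (fun i => (k (hB.eigenvalues i) : ℂ)) * star (star U * V))).trace := by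
    rw [h1, h2, star_mul, star_star, mul_assoc U, mul_assoc U, trace_mul_comm U]
    simp only [mul_assoc]
  rw [h3, trace, Complex.re_sum]
  refine Finset.sum_congr rfl fun i _ => ?_
  rw [diag_apply, mul_apply, Complex.re_sum]
  refine Finset.sum_congr rfl fun j _ => ?_
  rw [diagonal_mul, diagonal_mul, star_apply]
  set z := (star U * V) i j
  simp [Complex.normSq_apply]
  ring

theorem Matrix.re_trace_cfc {A : Matrix n n ℂ} (hA : A.IsHermitian) (f : ℝ → ℝ) :
    (cfc f A).trace.re = ∑ i, f (hA.eigenvalues i) := by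
  rw [hA.cfc_eq, IsHermitian.cfc, Unitary.conjStarAlgAut_apply, trace_mul_comm, ← mul_assoc]
  simp [trace]

/-- **Klein's inequality**: the trace of a convex function of a matrix lies above its tangents. -/
theorem Matrix.klein_inequality {A B : Matrix n n ℂ} (hA : A.IsHermitian) (hB : B.IsHermitian)
    {s : Set ℝ} (hAs : spectrum ℝ A ⊆ s) (hBs : spectrum ℝ B ⊆ s) {f g : ℝ → ℝ}
    (h : ∀ x ∈ s, ∀ y ∈ s, g x * (y - x) ≤ f y - f x) :
    (cfc g A * (B - A)).trace.re ≤ (cfc f B).trace.re - (cfc f A).trace.re := by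
  obtain ⟨w, hw, hwt⟩ := exists_re_trace_cfc_mul_cfc hA hB
  have hA' : IsSelfAdjoint A := hA
  have hB' : IsSelfAdjoint B := hB
  have e1 : (cfc g A * B).trace.re = (cfc g A * cfc (fun x : ℝ => x) B).trace.re := by
    rw [cfc_id' ℝ B]
  have e2 : (cfc g A * A).trace.re =
      (cfc (fun x : ℝ => g x * x) A * cfc (fun _ : ℝ => 1) B).trace.re := by
    rw [cfc_const_one ℝ B, mul_one, cfc_mul g (fun x => x) A (continuousOn_spectrum _ _),
      cfc_id' ℝ A]
  have e3 : (cfc f B).trace.re = (cfc (fun _ : ℝ => 1) A * cfc f B).trace.re := by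
    rw [cfc_const_one ℝ A, one_mul]
  have e4 : (cfc f A).trace.re = (cfc f A * cfc (fun _ : ℝ => 1) B).trace.re := by
    rw [cfc_const_one ℝ B, mul_one]
  rw [mul_sub, trace_sub, Complex.sub_re, e1, e2, e3, e4]
  simp only [hwt, ← Finset.sum_sub_distrib, ← mul_sub]
  refine Finset.sum_le_sum fun i _ => Finset.sum_le_sum fun j _ =>
    mul_le_mul_of_nonneg_left ?_ (hw i j)
  have := h _ (hAs (hA.eigenvalues_mem_spectrum_real i)) _
    (hBs (hB.eigenvalues_mem_spectrum_real j))
  linarith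

theorem Matrix.re_trace_mul_nonneg {A B : Matrix n n ℂ} (hA : 0 ≤ A) (hB : 0 ≤ B) :
    0 ≤ (A * B).trace.re := by
  have hBB : B = CFC.sqrt B * CFC.sqrt B := (CFC.sqrt_mul_sqrt_self B).symm
  have hs : star (CFC.sqrt B) = CFC.sqrt B := (CFC.sqrt_nonneg B).isSelfAdjoint
  rw [hBB, ← mul_assoc, trace_mul_comm, ← mul_assoc]
  have h := star_left_conjugate_nonneg hA (CFC.sqrt B)
  rw [hs] at h
  exact (Complex.le_def.1 (nonneg_iff_posSemidef.1 h).trace_nonneg).1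

theorem Matrix.re_trace_mul_le {A B C : Matrix n n ℂ} (h : A ≤ B) (hC : 0 ≤ C) :
    (A * C).trace.re ≤ (B * C).trace.re := by
  have := re_trace_mul_nonneg (sub_nonneg.2 h) hC
  rw [sub_mul, trace_sub, Complex.sub_re] at this
  linarith

theorem Matrix.spectrum_subset_Icc {A : Matrix n n ℂ} {r b : ℝ}
    (h0 : algebraMap ℝ _ r ≤ A) (hb : A ≤ algebraMap ℝ _ b) (hA : IsSelfAdjoint A) :
    spectrum ℝ A ⊆ Set.Icc r b := fun x hx =>
  ⟨(algebraMap_le_iff_le_spectrum (a := A)).1 h0 x hx,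
    (le_algebraMap_iff_spectrum_le (a := A)).1 hb x hx⟩

/-- Compression inequality for `x ↦ x * g x` with `g` operator monotone. -/
theorem Matrix.compression_cfc_le {g : ℝ → ℝ} {b : ℝ}
    (hg : ∀ A B : Matrix n n ℂ, 0 ≤ A → A ≤ B → B ≤ algebraMap ℝ _ b → cfc g A ≤ cfc g B)
    {Z P : Matrix n n ℂ} (hZ : 0 ≤ Z) (hZb : Z ≤ algebraMap ℝ _ b)
    (hP : IsStarProjection P) :
    P * Z * P * cfc g (P * Z * P) ≤ P * (Z * cfc g Z) * P := by
  have hPs : star P = P := hP.isSelfAdjoint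
  have hPP : P * P = P := hP.isIdempotentElem
  set R := CFC.sqrt Z with hR
  have hRR : R * R = Z := CFC.sqrt_mul_sqrt_self Z
  have hRs : star R = R := (CFC.sqrt_nonneg Z).isSelfAdjoint
  have hZs : IsSelfAdjoint Z := hZ.isSelfAdjoint
  have hRPR0 : 0 ≤ R * P * R := by
    simpa [hRs] using star_left_conjugate_nonneg hP.nonneg R
  have hRPR : R * P * R ≤ Z := by
    have := star_left_conjugate_le_conjugate hP.le_one R
    rwa [hRs, mul_one, hRR] at this
  have key := star_left_conjugate_le_conjugate (hg _ _ hRPR0 hRPR hZb) (R * P)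
  rw [star_mul, hRs, hPs] at key
  have hPZP : IsSelfAdjoint (P * Z * P) := by
    rw [isSelfAdjoint_iff, star_mul, star_mul, hPs, hZs.star_eq, mul_assoc]
  have h1 : SemiconjBy (P * R) (cfc g (R * P * R)) (cfc g (P * Z * P)) :=
    semiconjBy_cfc hRPR0.isSelfAdjoint hPZP (by
      rw [SemiconjBy, ← hRR]
      simp only [mul_assoc]
      simp only [← mul_assoc P P, hPP]) g
  have h2 : SemiconjBy R (cfc g Z) (cfc g Z) :=
    semiconjBy_cfc hZs hZs (by rw [SemiconjBy, ← hRR, mul_assoc]) g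
  have h3 : SemiconjBy (P * Z * P) (cfc g (P * Z * P)) (cfc g (P * Z * P)) :=
    semiconjBy_cfc hPZP hPZP rfl g
  have h4 : SemiconjBy Z (cfc g Z) (cfc g Z) := semiconjBy_cfc hZs hZs rfl g
  have e1 : P * R * cfc g (R * P * R) * (R * P) = P * Z * P * cfc g (P * Z * P) := by
    rw [h1.eq, h3.eq, ← hRR]
    simp only [mul_assoc]
  have e2 : P * R * cfc g Z * (R * P) = P * (Z * cfc g Z) * P := by
    rw [mul_assoc P, h2.eq, mul_assoc, mul_assoc, ← mul_assoc R, hRR, ← mul_assoc (cfc g Z),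
      ← h4.eq, ← mul_assoc]
  rwa [e1, e2] at key

section Interpolation

variable {Z P Q : Matrix n n ℂ}

/-- The congruence of `Z` that rescales the range of the projection `Q` by `s`. -/
noncomputable def Matrix.rescale (Z Q : Matrix n n ℂ) (s : ℝ) : Matrix n n ℂ :=
  (1 + (s - 1) • Q) * Z * (1 + (s - 1) • Q)

/-- The derivative of `s ↦ Matrix.rescale Z Q s`. -/
noncomputable def Matrix.rescaleDeriv (Z Q : Matrix n n ℂ) (s : ℝ) : Matrix n n ℂ :=
  Q * Z * (1 + (s - 1) • Q) + (1 + (s - 1) • Q) * Z * Q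

theorem Matrix.rescale_add (Z Q : Matrix n n ℂ) (s δ : ℝ) :
    rescale Z Q (s + δ) = rescale Z Q s + δ • rescaleDeriv Z Q s + δ ^ 2 • (Q * Z * Q) := by
  have : (1 + (s + δ - 1) • Q : Matrix n n ℂ) = (1 + (s - 1) • Q) + δ • Q := by module
  rw [rescale, rescale, rescaleDeriv, this]
  generalize (1 + (s - 1) • Q : Matrix n n ℂ) = D
  simp only [add_mul, mul_add, smul_mul_assoc, mul_smul_comm]
  module

theorem Matrix.smul_rescaleDeriv (Z : Matrix n n ℂ) (hQ : IsIdempotentElem Q) (s : ℝ) :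
    s • rescaleDeriv Z Q s = Q * rescale Z Q s + rescale Z Q s * Q := by
  have h1 : Q * (1 + (s - 1) • Q) = s • Q := by
    rw [mul_add, mul_smul_comm, hQ.eq, mul_one]; module
  have h2 : (1 + (s - 1) • Q) * Q = s • Q := by
    rw [add_mul, smul_mul_assoc, hQ.eq, one_mul]; module
  rw [rescale, rescaleDeriv, mul_assoc _ (1 + (s - 1) • Q) Q, h2, ← mul_assoc Q, ← mul_assoc Q, h1]
  simp only [smul_mul_assoc, mul_smul_comm, smul_add, mul_assoc]

theorem Matrix.rescale_nonneg (hZ : 0 ≤ Z) (hQ : IsStarProjection Q) (s : ℝ) :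
    0 ≤ rescale Z Q s := by
  have hD : star (1 + (s - 1) • Q) = 1 + (s - 1) • Q := by
    simp [hQ.isSelfAdjoint.star_eq]
  simpa [hD, rescale] using star_left_conjugate_nonneg hZ (1 + (s - 1) • Q)

theorem Matrix.rescale_le {b : ℝ} (hb : 0 ≤ b) (hZb : Z ≤ algebraMap ℝ _ b)
    (hQ : IsStarProjection Q) {s : ℝ} (hs : s ∈ Set.Icc (0 : ℝ) 1) :
    rescale Z Q s ≤ algebraMap ℝ _ b := by
  have hD : star (1 + (s - 1) • Q) = 1 + (s - 1) • Q := by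
    simp [hQ.isSelfAdjoint.star_eq]
  have h := star_left_conjugate_le_conjugate hZb (1 + (s - 1) • Q)
  rw [hD] at h
  refine h.trans ?_
  have hQQ : Q * Q = Q := hQ.isIdempotentElem
  have : (1 + (s - 1) • Q) * algebraMap ℝ (Matrix n n ℂ) b * (1 + (s - 1) • Q) =
      algebraMap ℝ _ b - (b * (1 - s ^ 2)) • Q := by
    rw [Algebra.algebraMap_eq_smul_one]
    simp only [add_mul, mul_add, smul_mul_assoc, mul_smul_comm, hQQ, one_mul, mul_one]
    module
  rw [this, sub_le_self_iff]
  have := hs.1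
  have := hs.2
  exact smul_nonneg (mul_nonneg hb (by nlinarith)) hQ.nonneg

theorem Matrix.compression_le {b : ℝ} (hb : 0 ≤ b) (hZb : Z ≤ algebraMap ℝ _ b)
    (hP : IsStarProjection P) : P * Z * P ≤ algebraMap ℝ _ b := by
  have h := star_left_conjugate_le_conjugate hZb P
  rw [hP.isSelfAdjoint.star_eq] at h
  refine h.trans ?_
  rw [Algebra.algebraMap_eq_smul_one, mul_smul_comm, smul_mul_assoc, mul_one, hP.isIdempotentElem.eq]
  exact smul_le_smul_of_nonneg_left hP.le_one hb

theorem Matrix.algebraMap_le_cfc {g : ℝ → ℝ} {b : ℝ} (hg : MonotoneOn g (Set.Icc 0 b))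
    {A : Matrix n n ℂ} (hA : 0 ≤ A) (hAb : A ≤ algebraMap ℝ _ b) :
    algebraMap ℝ _ (g 0) ≤ cfc g A := by
  refine _root_.algebraMap_le_cfc g (g 0) A (fun x hx => ?_) (continuousOn_spectrum g A)
    hA.isSelfAdjoint
  have h := spectrum_subset_Icc (r := 0) (by simpa using hA) hAb hA.isSelfAdjoint hx
  exact hg ⟨le_rfl, h.1.trans h.2⟩ h h.1

/-- Along the rescaling of a range contained in that of `P`, the trace of a primitive of `g` grows
faster at the full matrix than at its compression by `P`. -/
theorem Matrix.re_trace_cfc_mul_rescaleDeriv_le {g : ℝ → ℝ} {b : ℝ} (hb : 0 ≤ b)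
    (hg : ∀ A B : Matrix n n ℂ, 0 ≤ A → A ≤ B → B ≤ algebraMap ℝ _ b → cfc g A ≤ cfc g B)
    (hZ : 0 ≤ Z) (hZb : Z ≤ algebraMap ℝ _ b) (hP : IsStarProjection P)
    (hQ : IsStarProjection Q) (hPQ : P * Q = Q) (hQP : Q * P = Q) {s : ℝ}
    (hs : s ∈ Set.Ioc (0 : ℝ) 1) :
    (cfc g (P * rescale Z Q s * P) * (P * rescaleDeriv Z Q s * P)).trace.re ≤
      (cfc g (rescale Z Q s) * rescaleDeriv Z Q s).trace.re := by
  set W := rescale Z Q s with hW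
  have hW0 : 0 ≤ W := rescale_nonneg hZ hQ s
  have hWb : W ≤ algebraMap ℝ _ b := rescale_le hb hZb hQ ⟨hs.1.le, hs.2⟩
  have htr : ∀ Y : Matrix n n ℂ, 0 ≤ Y →
      (cfc g Y * (Q * Y + Y * Q)).trace.re = 2 * (Y * cfc g Y * Q).trace.re := by
    intro Y hY
    have hc : Y * cfc g Y = cfc g Y * Y :=
      semiconjBy_cfc hY.isSelfAdjoint hY.isSelfAdjoint rfl g
    rw [mul_add, trace_add, ← mul_assoc, trace_mul_comm, ← mul_assoc, ← mul_assoc, ← hc,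
      Complex.add_re]
    ring
  have hsub : s • (P * rescaleDeriv Z Q s * P) = Q * (P * W * P) + P * W * P * Q := by
    rw [← smul_mul_assoc, ← mul_smul_comm, smul_rescaleDeriv Z hQ.isIdempotentElem, ← hW, mul_add,
      add_mul, ← mul_assoc P Q, hPQ, ← mul_assoc P W, mul_assoc (P * W) Q, hQP,
      mul_assoc (P * W) P, hPQ, ← mul_assoc Q, ← mul_assoc Q, hQP]
  refine le_of_mul_le_mul_left ?_ hs.1
  have hre : ∀ Y : Matrix n n ℂ, s * Y.trace.re = (s • Y).trace.re := by
    intro Y; simp [trace_smul]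
  rw [hre, hre, ← mul_smul_comm s (cfc g (P * W * P)), ← mul_smul_comm s (cfc g W), hsub,
    smul_rescaleDeriv Z hQ.isIdempotentElem,
    ← hW, htr _ hW0, htr _ (compression_nonneg hW0 hP)]
  have h := re_trace_mul_le (compression_cfc_le hg hW0 hWb hP) hQ.nonneg
  rw [mul_assoc _ P Q, hPQ, mul_assoc P (W * cfc g W) Q, trace_mul_comm P,
    mul_assoc _ Q P, hQP] at h
  linarith

theorem le_of_forall_sub_mul_sub_le {G m : ℝ → ℝ} {C : ℝ}
    (h : ∀ s δ : ℝ, 0 ≤ s → 0 < δ → s + δ ≤ 1 →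
      δ * (m s - m (s + δ)) + C * δ ^ 2 ≤ G (s + δ) - G s) : G 0 ≤ G 1 := by
  have key : ∀ N : ℕ, (m 0 - m 1 + C) * (1 / ((N : ℝ) + 1)) ≤ G 1 - G 0 := by
    intro N
    set δ : ℝ := 1 / ((N : ℝ) + 1) with hδ
    have hδ0 : 0 < δ := by positivity
    have hN : ((N + 1 : ℕ) : ℝ) * δ = 1 := by rw [hδ]; push_cast; field_simp
    have hk : ∀ k : ℕ, k ≤ N + 1 →
        δ * (m 0 - m (k * δ)) + k * (C * δ ^ 2) ≤ G (k * δ) - G 0 := by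
      intro k
      induction k with
      | zero => simp
      | succ k ih =>
        intro hk
        have h1 := ih (by omega)
        have h2 : (k + 1 : ℝ) * δ ≤ 1 := by
          have hk' : (k + 1 : ℝ) ≤ ((N + 1 : ℕ) : ℝ) := by exact_mod_cast hk
          exact (mul_le_mul_of_nonneg_right hk' hδ0.le).trans hN.le
        have h3 := h (k * δ) δ (by positivity) hδ0 (by linarith)
        have h4 : ((k + 1 : ℕ) : ℝ) * δ = k * δ + δ := by push_cast; ring
        rw [h4]
        push_cast
        linarith
    have h1 := hk (N + 1) le_rfl
    have h2 : ((N + 1 : ℕ) : ℝ) * (C * δ ^ 2) = C * δ := by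
      rw [show ((N + 1 : ℕ) : ℝ) * (C * δ ^ 2) = C * δ * (((N + 1 : ℕ) : ℝ) * δ) by ring, hN,
        mul_one]
    rw [h2, hN] at h1
    linarith
  have hlim := (tendsto_one_div_add_atTop_nhds_zero_nat (𝕜 := ℝ)).const_mul (m 0 - m 1 + C)
  rw [mul_zero] at hlim
  linarith [le_of_tendsto' hlim key]

/-- The loss in the trace of `f` caused by compression to the range of `P` decreases when a part of
that range is shrunk to zero. -/
theorem Matrix.re_trace_cfc_compression_le {f g : ℝ → ℝ} {b : ℝ} (hb : 0 ≤ b)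
    (hg : ∀ A B : Matrix n n ℂ, 0 ≤ A → A ≤ B → B ≤ algebraMap ℝ _ b → cfc g A ≤ cfc g B)
    (hgm : MonotoneOn g (Set.Icc 0 b))
    (hfg : ∀ x ∈ Set.Icc 0 b, ∀ y ∈ Set.Icc 0 b, g x * (y - x) ≤ f y - f x)
    (hZ : 0 ≤ Z) (hZb : Z ≤ algebraMap ℝ _ b) (hP : IsStarProjection P)
    (hQ : IsStarProjection Q) (hPQ : P * Q = Q) (hQP : Q * P = Q) :
    (cfc f (rescale Z Q 0)).trace.re - (cfc f (P * rescale Z Q 0 * P)).trace.re ≤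
      (cfc f (rescale Z Q 1)).trace.re - (cfc f (P * rescale Z Q 1 * P)).trace.re := by
  let k : ℝ → ℝ := fun s => (cfc g (rescale Z Q s) * rescaleDeriv Z Q s).trace.re
  let kP : ℝ → ℝ := fun s =>
    (cfc g (P * rescale Z Q s * P) * (P * rescaleDeriv Z Q s * P)).trace.re
  have hQZQ : 0 ≤ Q * Z * Q := compression_nonneg hZ hQ
  have hW0 (s : ℝ) : 0 ≤ rescale Z Q s := rescale_nonneg hZ hQ s
  have hWb (s : ℝ) (hs : s ∈ Set.Icc (0 : ℝ) 1) : rescale Z Q s ≤ algebraMap ℝ _ b :=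
    rescale_le hb hZb hQ hs
  have hspec (Y : Matrix n n ℂ) (h0 : 0 ≤ Y) (h1 : Y ≤ algebraMap ℝ _ b) :
      spectrum ℝ Y ⊆ Set.Icc 0 b :=
    spectrum_subset_Icc (by simpa using h0) h1 h0.isSelfAdjoint
  have hlow (Y : Matrix n n ℂ) (h0 : 0 ≤ Y) (h1 : Y ≤ algebraMap ℝ _ b) :
      g 0 * (Q * Z * Q).trace.re ≤ (cfc g Y * (Q * Z * Q)).trace.re := by
    have := re_trace_mul_le (Matrix.algebraMap_le_cfc hgm h0 h1) hQZQ
    rwa [Algebra.algebraMap_eq_smul_one, smul_mul_assoc, one_mul, trace_smul, Complex.smul_re,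
      smul_eq_mul] at this
  refine le_of_forall_sub_mul_sub_le
    (G := fun s => (cfc f (rescale Z Q s)).trace.re - (cfc f (P * rescale Z Q s * P)).trace.re)
    (m := fun s => if s = 0 then k 0 else kP s) (C := 2 * (g 0 * (Q * Z * Q).trace.re)) ?_
  intro s δ hs hδ hsδ
  have hm : (if s = 0 then k 0 else kP s) ≤ k s := by
    split_ifs with h
    · rw [h]
    · exact re_trace_cfc_mul_rescaleDeriv_le hb hg hZ hZb hP hQ hPQ hQP
        ⟨lt_of_le_of_ne hs (Ne.symm h), by linarith⟩
  have hsI : s ∈ Set.Icc (0 : ℝ) 1 := ⟨hs, by linarith⟩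
  have hsI' : s + δ ∈ Set.Icc (0 : ℝ) 1 := ⟨by linarith, hsδ⟩
  have hPW0 (s : ℝ) : 0 ≤ P * rescale Z Q s * P := compression_nonneg (hW0 s) hP
  have hPWb (s : ℝ) (hs : s ∈ Set.Icc (0 : ℝ) 1) : P * rescale Z Q s * P ≤ algebraMap ℝ _ b :=
    compression_le hb (hWb s hs) hP
  have kl1 := klein_inequality (hW0 s).isSelfAdjoint (hW0 (s + δ)).isSelfAdjoint
    (hspec _ (hW0 s) (hWb s hsI)) (hspec _ (hW0 _) (hWb _ hsI')) hfg
  have kl2 := klein_inequality (hPW0 (s + δ)).isSelfAdjoint (hPW0 s).isSelfAdjoint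
    (hspec _ (hPW0 _) (hPWb _ hsI')) (hspec _ (hPW0 _) (hPWb _ hsI)) hfg
  have d1 : rescale Z Q (s + δ) - rescale Z Q s =
      δ • rescaleDeriv Z Q s + δ ^ 2 • (Q * Z * Q) := by
    rw [rescale_add]; abel
  have d2 : P * rescale Z Q s * P - P * rescale Z Q (s + δ) * P =
      (-δ) • (P * rescaleDeriv Z Q (s + δ) * P) + δ ^ 2 • (Q * Z * Q) := by
    have e := rescale_add Z Q (s + δ) (-δ)
    rw [add_neg_cancel_right, neg_sq] at e
    rw [e]
    simp only [mul_add, add_mul, mul_smul_comm, smul_mul_assoc]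
    rw [mul_assoc P (Q * Z * Q) P, mul_assoc (Q * Z) Q P, hQP, ← mul_assoc P (Q * Z),
      ← mul_assoc P Q, hPQ]
    abel
  have hexp (A B C : Matrix n n ℂ) (x y : ℝ) : (A * (x • B + y • C)).trace.re =
      x * (A * B).trace.re + y * (A * C).trace.re := by
    simp [mul_add, trace_add, trace_smul]
  rw [d1, hexp] at kl1
  rw [d2, hexp] at kl2
  have l1 := hlow _ (hW0 s) (hWb s hsI)
  have l2 := hlow _ (hPW0 (s + δ)) (hPWb _ hsI')
  have hne : s + δ ≠ 0 := by linarith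
  simp only [if_neg hne]
  have hδ2 : 0 ≤ δ ^ 2 := sq_nonneg δ
  have m1 := mul_le_mul_of_nonneg_left l1 hδ2
  have m2 := mul_le_mul_of_nonneg_left l2 hδ2
  have m3 := mul_le_mul_of_nonneg_left hm hδ.le
  simp only [k, kP] at m3 ⊢
  linarith

end Interpolation

theorem Matrix.cfc_comp_add (g : ℝ → ℝ) (a : ℝ) {A : Matrix n n ℂ} (hA : IsSelfAdjoint A) :
    cfc (fun x => g (a + x)) A = cfc g (algebraMap ℝ _ a + A) := by
  rw [cfc_comp' g (fun x => a + x) A ((A.finite_real_spectrum.image _).continuousOn g)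
    (continuousOn_spectrum _ _), cfc_const_add a (fun x => x) A, cfc_id' ℝ A]

theorem hermApply_eq_cfc {m : ℕ} {A : Matrix (Fin m) (Fin m) ℂ} (hA : A.IsHermitian)
    (g : ℝ → ℝ) : hermApply A hA g = cfc g A := by
  rw [hA.cfc_eq]; rfl

theorem OperatorMonotoneOn.cfc_le_cfc {g : ℝ → ℝ} {E : Set ℝ} (hg : OperatorMonotoneOn g E)
    {m : ℕ} {A B : Matrix (Fin m) (Fin m) ℂ} (hA : A.IsHermitian) (hB : B.IsHermitian)
    (hAE : spectrum ℝ A ⊆ E) (hBE : spectrum ℝ B ⊆ E) (h : A ≤ B) : cfc g A ≤ cfc g B := by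
  have := hg m B A hB hA (fun i => hBE (hB.eigenvalues_mem_spectrum_real i))
    (fun i => hAE (hA.eigenvalues_mem_spectrum_real i)) h
  rwa [hermApply_eq_cfc, hermApply_eq_cfc] at this

theorem OperatorMonotoneOn.monotoneOn {g : ℝ → ℝ} {E : Set ℝ} (hg : OperatorMonotoneOn g E) :
    MonotoneOn g E := by
  intro x hx y hy hxy
  have hle (u v : ℝ) : algebraMap ℝ (Matrix (Fin 1) (Fin 1) ℂ) u ≤ algebraMap ℝ _ v ↔ u ≤ v := by
    rw [algebraMap_le_iff_le_spectrum (a := algebraMap ℝ (Matrix (Fin 1) (Fin 1) ℂ) v)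
      (IsSelfAdjoint.algebraMap _ (IsSelfAdjoint.all v)), spectrum.scalar_eq]
    simp
  have hsp (u : ℝ) (hu : u ∈ E) : spectrum ℝ (algebraMap ℝ (Matrix (Fin 1) (Fin 1) ℂ) u) ⊆ E := by
    rw [spectrum.scalar_eq]
    simpa using hu
  have := hg.cfc_le_cfc (IsSelfAdjoint.algebraMap _ (IsSelfAdjoint.all x))
    (IsSelfAdjoint.algebraMap _ (IsSelfAdjoint.all y)) (hsp x hx) (hsp y hy) ((hle x y).2 hxy)
  rwa [cfc_algebraMap, cfc_algebraMap, hle] at this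

/-- A primitive of a monotone function lies above its tangents. -/
theorem MonotoneOn.mul_sub_le_of_hasDerivAt {f g : ℝ → ℝ} {E : Set ℝ} (hE : E.OrdConnected)
    (hg : MonotoneOn g E) (hf : ∀ x ∈ E, HasDerivAt f (g x) x) {x y : ℝ} (hx : x ∈ E)
    (hy : y ∈ E) : g x * (y - x) ≤ f y - f x := by
  have hslope {u v : ℝ} (hu : u ∈ E) (hv : v ∈ E) (huv : u < v) :
      ∃ c ∈ E, u ≤ c ∧ c ≤ v ∧ g c * (v - u) = f v - f u := by
    have hsub : Set.Icc u v ⊆ E := hE.out hu hv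
    obtain ⟨c, hc, hcs⟩ := exists_hasDerivAt_eq_slope f g huv
      (fun z hz => (hf z (hsub hz)).continuousAt.continuousWithinAt)
      (fun z hz => hf z (hsub ⟨hz.1.le, hz.2.le⟩))
    refine ⟨c, hsub ⟨hc.1.le, hc.2.le⟩, hc.1.le, hc.2.le, ?_⟩
    rw [hcs, div_mul_cancel₀ _ (sub_pos.2 huv).ne']
  rcases lt_trichotomy x y with h | rfl | h
  · obtain ⟨c, hc, h1, -, h3⟩ := hslope hx hy h
    nlinarith [hg hx hc h1]
  · simp
  · obtain ⟨c, hc, -, h2, h3⟩ := hslope hy hx h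
    nlinarith [hg hc hx h2]

/-- The coordinate projection onto the indices in `A`. -/
noncomputable def Matrix.coordProj (A : Finset n) : Matrix n n ℂ :=
  diagonal fun i => if i ∈ A then 1 else 0

theorem Matrix.coordProj_mul_coordProj (A B : Finset n) :
    coordProj A * coordProj B = coordProj (A ∩ B) := by
  rw [coordProj, coordProj, coordProj, diagonal_mul_diagonal]
  congr 1
  ext i
  by_cases hA : i ∈ A <;> by_cases hB : i ∈ B <;> simp [hA, hB]

theorem Matrix.isStarProjection_coordProj (A : Finset n) :
    IsStarProjection (coordProj A : Matrix n n ℂ) where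
  isIdempotentElem := by
    rw [IsIdempotentElem, coordProj_mul_coordProj, Finset.inter_self]
  isSelfAdjoint := by
    rw [isSelfAdjoint_iff, coordProj, star_eq_conjTranspose, diagonal_conjTranspose]
    congr 1
    ext i
    by_cases hA : i ∈ A <;> simp [hA]

/-- Compressing `X - a` by a coordinate projection adds zero eigenvalues to those of the principal
submatrix of `X - a`. -/
theorem Matrix.re_trace_cfc_coordProj {X : Matrix n n ℂ} (hX : X.IsHermitian) (a : ℝ)
    (f : ℝ → ℝ) (A : Finset n) :
    (cfc (fun x => f (a + x))
      (coordProj A * (X - algebraMap ℝ _ a) * coordProj A)).trace.re =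
      ∑ k, f ((hX.submatrix (Subtype.val : {x // x ∈ A} → n)).eigenvalues k) +
        (Fintype.card n - A.card) * f a := by
  set Y := coordProj A * (X - algebraMap ℝ _ a) * coordProj A with hY
  have hXa : IsSelfAdjoint (X - algebraMap ℝ _ a) :=
    IsSelfAdjoint.sub hX (IsSelfAdjoint.algebraMap _ (IsSelfAdjoint.all a))
  have hP : star (coordProj A : Matrix n n ℂ) = coordProj A :=
    (isStarProjection_coordProj A).isSelfAdjoint
  have hYs : IsSelfAdjoint Y := by
    rw [isSelfAdjoint_iff, hY, star_mul, star_mul, hP, hXa.star_eq, mul_assoc]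
  have hYa : (algebraMap ℝ _ a + Y).IsHermitian :=
    (IsSelfAdjoint.algebraMap _ (IsSelfAdjoint.all a)).add hYs
  rw [cfc_comp_add f a hYs, re_trace_cfc hYa]
  let XA := X.submatrix (Subtype.val : {x // x ∈ A} → n) (Subtype.val : {x // x ∈ A} → n)
  have hblock : reindex (Equiv.sumCompl (· ∈ A)).symm (Equiv.sumCompl (· ∈ A)).symm
      (algebraMap ℝ _ a + Y) =
      fromBlocks XA 0 0 (diagonal fun _ : {x // x ∉ A} => (a : ℂ)) := by
    have hentry (i j : n) : (algebraMap ℝ (Matrix n n ℂ) a + Y) i j =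
        if i ∈ A ∧ j ∈ A then X i j else if i = j then (a : ℂ) else 0 := by
      simp only [hY, coordProj, add_apply, mul_diagonal, diagonal_mul, sub_apply,
        algebraMap_matrix_apply]
      by_cases hi : i ∈ A <;> by_cases hj : j ∈ A <;> simp [hi, hj]
    ext (i | i) (j | j)
    · simp [hentry, XA]
    · have : (i : n) ≠ j := fun h => j.2 (h ▸ i.2)
      simp [hentry, this, j.2]
    · have : (i : n) ≠ j := fun h => i.2 (h ▸ j.2)
      simp [hentry, this, i.2]
    · simp [hentry, i.2, diagonal_apply, Subtype.ext_iff]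
  have hchar : (algebraMap ℝ _ a + Y).charpoly =
      XA.charpoly * (Polynomial.X - Polynomial.C (a : ℂ)) ^ (Fintype.card n - A.card) := by
    rw [← charpoly_reindex (Equiv.sumCompl (· ∈ A)).symm, hblock, charpoly_fromBlocks_zero₁₂,
      charpoly_diagonal, Finset.prod_const, Finset.card_univ, Fintype.card_subtype_compl]
    simp
  have hXA : XA.IsHermitian := hX.submatrix _
  have hroots := congrArg Polynomial.roots hchar
  rw [Polynomial.roots_mul (mul_ne_zero XA.charpoly_monic.ne_zero
    (pow_ne_zero _ (Polynomial.X_sub_C_ne_zero _))), Polynomial.roots_pow,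
    Polynomial.roots_X_sub_C, hYa.roots_charpoly_eq_eigenvalues,
    hXA.roots_charpoly_eq_eigenvalues] at hroots
  have hsum := congrArg (fun M : Multiset ℂ => (M.map fun z => f z.re).sum) hroots
  simp only [Multiset.map_map, Multiset.map_add, Multiset.sum_add, Multiset.map_nsmul,
    Multiset.sum_nsmul] at hsum
  simp only [Function.comp_def, Multiset.map_singleton, Multiset.sum_singleton, nsmul_eq_mul,
    Nat.cast_sub (Finset.card_le_univ A)] at hsum
  exact hsum

/-- Supermodularity of the trace of a primitive of an operator monotone function on principal
submatrices. -/
theorem OperatorMonotoneOn.supermodular_sum_eigenvalues {N : ℕ} {E : Set ℝ}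
    (hE : E.OrdConnected) {φ φ' : ℝ → ℝ} (hderiv : ∀ x ∈ E, HasDerivAt φ (φ' x) x)
    {X : Matrix (Fin N) (Fin N) ℂ} (hX : X.IsHermitian)
    (hspec : ∀ i, hX.eigenvalues i ∈ E) (hφ : OperatorMonotoneOn φ' E) (S T : Finset (Fin N)) :
    (∑ k : {x // x ∈ S},
        φ ((hX.submatrix (Subtype.val : {x // x ∈ S} → Fin N)).eigenvalues k)) +
      (∑ k : {x // x ∈ T},
        φ ((hX.submatrix (Subtype.val : {x // x ∈ T} → Fin N)).eigenvalues k)) ≤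
    (∑ k : {x // x ∈ S ∪ T},
        φ ((hX.submatrix (Subtype.val : {x // x ∈ S ∪ T} → Fin N)).eigenvalues k)) +
      (∑ k : {x // x ∈ S ∩ T},
        φ ((hX.submatrix (Subtype.val : {x // x ∈ S ∩ T} → Fin N)).eigenvalues k)) := by
  rcases isEmpty_or_nonempty (Fin N) with hN | hN
  · simp
  obtain ⟨imin, hmin⟩ := Finite.exists_min hX.eigenvalues
  obtain ⟨imax, hmax⟩ := Finite.exists_max hX.eigenvalues
  set a := hX.eigenvalues imin
  set b := hX.eigenvalues imax - a
  have hb : 0 ≤ b := sub_nonneg.2 (hmin imax)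
  have haE : a ∈ E := hspec imin
  have hshift {x : ℝ} (hx : x ∈ Set.Icc 0 b) : a + x ∈ E :=
    hE.out haE (hspec imax) ⟨by linarith [hx.1], by linarith [hx.2]⟩
  set g : ℝ → ℝ := fun x => φ' (a + x)
  set f : ℝ → ℝ := fun x => φ (a + x)
  set Z := X - algebraMap ℝ _ a
  have hsp (x : ℝ) (hx : x ∈ spectrum ℝ X) : a ≤ x ∧ x ≤ a + b := by
    rw [hX.spectrum_real_eq_range_eigenvalues] at hx
    obtain ⟨i, rfl⟩ := hx
    exact ⟨hmin i, by linarith [hmax i]⟩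
  have hZ : 0 ≤ Z :=
    sub_nonneg.2 ((algebraMap_le_iff_le_spectrum (a := X)).2 fun x hx => (hsp x hx).1)
  have hZb : Z ≤ algebraMap ℝ _ b := by
    rw [sub_le_iff_le_add', ← map_add]
    exact (le_algebraMap_iff_spectrum_le (a := X)).2 fun x hx => (hsp x hx).2
  have hφm := hφ.monotoneOn
  have hgm : MonotoneOn g (Set.Icc 0 b) := fun x hx y hy hxy =>
    hφm (hshift hx) (hshift hy) (by linarith)
  have hfg : ∀ x ∈ Set.Icc 0 b, ∀ y ∈ Set.Icc 0 b, g x * (y - x) ≤ f y - f x := by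
    intro x hx y hy
    have := hφm.mul_sub_le_of_hasDerivAt hE hderiv (hshift hx) (hshift hy)
    rwa [add_sub_add_left_eq_sub] at this
  have hg : ∀ A B : Matrix (Fin N) (Fin N) ℂ, 0 ≤ A → A ≤ B → B ≤ algebraMap ℝ _ b →
      cfc g A ≤ cfc g B := by
    have hadd {A : Matrix (Fin N) (Fin N) ℂ} (h0 : 0 ≤ A) (h1 : A ≤ algebraMap ℝ _ b) :
        IsSelfAdjoint (algebraMap ℝ _ a + A) ∧ spectrum ℝ (algebraMap ℝ _ a + A) ⊆ E := by
      have hs : IsSelfAdjoint (algebraMap ℝ _ a + A) :=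
        (IsSelfAdjoint.algebraMap _ (IsSelfAdjoint.all a)).add h0.isSelfAdjoint
      refine ⟨hs, (spectrum_subset_Icc (r := a) (b := a + b) ?_ ?_ hs).trans ?_⟩
      · exact le_add_of_nonneg_right h0
      · rw [map_add]; gcongr
      · exact hE.out haE (by simpa using hshift ⟨hb, le_rfl⟩)
    intro A B h0 hAB h1
    rw [cfc_comp_add φ' a h0.isSelfAdjoint, cfc_comp_add φ' a (h0.trans hAB).isSelfAdjoint]
    obtain ⟨hA, hAE⟩ := hadd h0 (hAB.trans h1)
    obtain ⟨hB, hBE⟩ := hadd (h0.trans hAB) h1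
    exact hφ.cfc_le_cfc hA hB hAE hBE (by gcongr)
  have hU := isStarProjection_coordProj (S ∪ T)
  have hTQ : T ∩ (T \ S) = T \ S := Finset.inter_eq_right.2 Finset.sdiff_subset
  have hQT : (T \ S) ∩ T = T \ S := Finset.inter_eq_left.2 Finset.sdiff_subset
  have main := re_trace_cfc_compression_le hb hg hgm hfg (compression_nonneg hZ hU)
    (compression_le hb hZb hU) (isStarProjection_coordProj T) (isStarProjection_coordProj (T \ S))
    (by rw [coordProj_mul_coordProj, hTQ]) (by rw [coordProj_mul_coordProj, hQT])
  have hone : rescale (coordProj (S ∪ T) * Z * coordProj (S ∪ T)) (coordProj (T \ S)) 1 =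
      coordProj (S ∪ T) * Z * coordProj (S ∪ T) := by
    simp [rescale]
  have hdiff : (1 + ((0 : ℝ) - 1) • coordProj (T \ S) : Matrix (Fin N) (Fin N) ℂ) =
      coordProj (S ∪ Tᶜ) := by
    ext i j
    by_cases hij : i = j
    · subst hij
      by_cases hS : i ∈ S <;> by_cases hT : i ∈ T <;> simp [coordProj, hS, hT]
    · simp [coordProj, hij]
  have hconj (A B : Finset (Fin N)) (Y : Matrix (Fin N) (Fin N) ℂ) :
      coordProj A * (coordProj B * Y * coordProj B) * coordProj A =
        coordProj (A ∩ B) * Y * coordProj (A ∩ B) := by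
    have hBA : coordProj B * coordProj A = (coordProj (A ∩ B) : Matrix (Fin N) (Fin N) ℂ) := by
      rw [coordProj_mul_coordProj, Finset.inter_comm]
    rw [← mul_assoc, ← mul_assoc, coordProj_mul_coordProj, mul_assoc _ (coordProj B), hBA]
  have hzero : rescale (coordProj (S ∪ T) * Z * coordProj (S ∪ T)) (coordProj (T \ S)) 0 =
      coordProj S * Z * coordProj S := by
    rw [rescale, hdiff, hconj]
    have : (S ∪ Tᶜ) ∩ (S ∪ T) = S := by
      ext i
      by_cases hS : i ∈ S <;> by_cases hT : i ∈ T <;> simp [hS, hT]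
    rw [this]
  have hTU : T ∩ (S ∪ T) = T := Finset.inter_eq_left.2 Finset.subset_union_right
  rw [hone, hzero, hconj, hconj, hTU, Finset.inter_comm T S] at main
  simp only [f, Z, re_trace_cfc_coordProj hX] at main
  have hcard : ((S ∪ T).card : ℝ) + (S ∩ T).card = S.card + T.card := by
    exact_mod_cast Finset.card_union_add_card_inter S T
  have hcard' := congrArg (· * φ a) hcard
  simp only [add_mul] at hcard'
  linarith

end

/-- Friedland–Gaubert: if `φ` is a primitive on the interval `E` of an operator antitone
function `φ'`, then for every Hermitian `X` with spectrum in `E`, the set function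
`A ↦ tr φ(X[A])` is submodular; dually, if `φ'` is operator monotone, it is
supermodular. -/
theorem trace_phi_submatrix_submodular_supermodular {N : ℕ} (E : Set ℝ)
    (hE : E.OrdConnected) (φ φ' : ℝ → ℝ) (hderiv : ∀ x ∈ E, HasDerivAt φ (φ' x) x)
    (X : Matrix (Fin N) (Fin N) ℂ) (hX : X.IsHermitian)
    (hspec : ∀ i, hX.eigenvalues i ∈ E) :
    (OperatorAntitoneOn φ' E → ∀ S T : Finset (Fin N),
      (∑ k : {x // x ∈ S ∪ T},
          φ ((hX.submatrix (Subtype.val : {x // x ∈ S ∪ T} → Fin N)).eigenvalues k)) +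
        (∑ k : {x // x ∈ S ∩ T},
          φ ((hX.submatrix (Subtype.val : {x // x ∈ S ∩ T} → Fin N)).eigenvalues k)) ≤
      (∑ k : {x // x ∈ S},
          φ ((hX.submatrix (Subtype.val : {x // x ∈ S} → Fin N)).eigenvalues k)) +
        (∑ k : {x // x ∈ T},
          φ ((hX.submatrix (Subtype.val : {x // x ∈ T} → Fin N)).eigenvalues k))) ∧
    (OperatorMonotoneOn φ' E → ∀ S T : Finset (Fin N),
      (∑ k : {x // x ∈ S},
          φ ((hX.submatrix (Subtype.val : {x // x ∈ S} → Fin N)).eigenvalues k)) +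
        (∑ k : {x // x ∈ T},
          φ ((hX.submatrix (Subtype.val : {x // x ∈ T} → Fin N)).eigenvalues k)) ≤
      (∑ k : {x // x ∈ S ∪ T},
          φ ((hX.submatrix (Subtype.val : {x // x ∈ S ∪ T} → Fin N)).eigenvalues k)) +
        (∑ k : {x // x ∈ S ∩ T},
          φ ((hX.submatrix (Subtype.val : {x // x ∈ S ∩ T} → Fin N)).eigenvalues k))) := by
  refine ⟨fun h S T => ?_, fun h S T =>
    h.supermodular_sum_eigenvalues hE hderiv hX hspec S T⟩
  have := OperatorMonotoneOn.supermodular_sum_eigenvalues hE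
    (fun x hx => (hderiv x hx).neg) hX hspec h S T
  simp only [Pi.neg_apply, Finset.sum_neg_distrib] at this
  linarith
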